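/- arXiv:1801.07460 — 5 statements merged into one kernel-verified Lean document; each statement's English description precedes it below -/
import Mathlib

section
/- Let α, β, γ, δ, ε, h be real numbers with h ≠ 0, set D := (ε − h⁴α)² − 4h⁶(h⁴ + h²β + δ), and assume D ≥ 0. Fix a sign σ ∈ {1, −1} and define b = (ε − h⁴α + σ√D)/(4h⁵), c = (ε − h⁴α − 3σ√D)/(4h⁴), k = −(17bh³ + 3h²(c + 2α) + γ)/(2h²(b² + 1)), p = (−bh³(b² + 3) + 2αh²(b² − 1) − ch²(3b² + 1) + 4bhβ + (1 − b²)γ)/(2h²(b² + 1)²), and q = (h³(2b⁴ + 4b² + 1) + bh²(b²c + 2α) + βh(1 − b²) − bγ)/(h²(b² + 1)²). Then α, β, γ, δ, ε are exactly the fold coefficients of (h, b, c, k, p, q), i.e., all five equations α = (−k − p + 2bq − b²k + b²p − 12bh − 2c)/4, β = h(q + 2bp − b²q + bc − h + 2b²h), γ = h²(3p − k − 6bq − b²k − 3b²p + 2bh)/2, δ = −h³(q + 2bp − b²q − bc), ε = h⁴(−k − p + 2bq − b²k + b²p + 2c)/4 hold. -/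
/-- Given `h ≠ 0`, `D ≥ 0` and a sign `σ ∈ {1, -1}`, the explicit values
`b, c, k, p, q` make `α, β, γ, δ, ε` the fold coefficients of `(h, b, c, k, p, q)`. -/
theorem fold_parameters_solve_system (α β γ δ ε h : ℝ) (hh : h ≠ 0)
    (D : ℝ) (hD : D = (ε - h ^ 4 * α) ^ 2 - 4 * h ^ 6 * (h ^ 4 + h ^ 2 * β + δ))
    (hDnonneg : 0 ≤ D)
    (σ : ℝ) (hσ : σ = 1 ∨ σ = -1)
    (b c k p q : ℝ)
    (hb : b = (ε - h ^ 4 * α + σ * Real.sqrt D) / (4 * h ^ 5))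
    (hc : c = (ε - h ^ 4 * α - 3 * σ * Real.sqrt D) / (4 * h ^ 4))
    (hk : k = -(17 * b * h ^ 3 + 3 * h ^ 2 * (c + 2 * α) + γ) / (2 * h ^ 2 * (b ^ 2 + 1)))
    (hp : p = (-(b * h ^ 3) * (b ^ 2 + 3) + 2 * α * h ^ 2 * (b ^ 2 - 1)
          - c * h ^ 2 * (3 * b ^ 2 + 1) + 4 * b * h * β + (1 - b ^ 2) * γ)
          / (2 * h ^ 2 * (b ^ 2 + 1) ^ 2))
    (hq : q = (h ^ 3 * (2 * b ^ 4 + 4 * b ^ 2 + 1) + b * h ^ 2 * (b ^ 2 * c + 2 * α)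
          + β * h * (1 - b ^ 2) - b * γ) / (h ^ 2 * (b ^ 2 + 1) ^ 2)) :
    α = (-k - p + 2 * b * q - b ^ 2 * k + b ^ 2 * p - 12 * b * h - 2 * c) / 4 ∧
    β = h * (q + 2 * b * p - b ^ 2 * q + b * c - h + 2 * b ^ 2 * h) ∧
    γ = h ^ 2 * (3 * p - k - 6 * b * q - b ^ 2 * k - 3 * b ^ 2 * p + 2 * b * h) / 2 ∧
    δ = -(h ^ 3) * (q + 2 * b * p - b ^ 2 * q - b * c) ∧
    ε = h ^ 4 * (-k - p + 2 * b * q - b ^ 2 * k + b ^ 2 * p + 2 * c) / 4 := by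
  have hb1 : b ^ 2 + 1 ≠ 0 := by positivity
  have hs : (σ * Real.sqrt D) ^ 2 = D := by
    rw [mul_pow, Real.sq_sqrt hDnonneg]
    rcases hσ with h1 | h1 <;> rw [h1] <;> ring
  have e1 : ε - h ^ 4 * α = h ^ 4 * (c + 3 * b * h) := by
    rw [hb, hc]
    field_simp
    ring
  have e2 : h ^ 4 + h ^ 2 * β + δ = 2 * h ^ 3 * b * (c + b * h) := by
    have hx : 2 * h ^ 3 * b * (c + b * h)
        = ((ε - h ^ 4 * α) ^ 2 - (σ * Real.sqrt D) ^ 2) / (4 * h ^ 6) := by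
      rw [hb, hc]
      field_simp
      ring
    rw [hx, hs, hD]
    field_simp
    ring
  clear hb hc hs hD
  have A : α = (-k - p + 2 * b * q - b ^ 2 * k + b ^ 2 * p - 12 * b * h - 2 * c) / 4 := by
    rw [hk, hp, hq]
    field_simp
    ring
  have B : β = h * (q + 2 * b * p - b ^ 2 * q + b * c - h + 2 * b ^ 2 * h) := by
    rw [hp, hq]
    field_simp
    ring
  have C : γ = h ^ 2 * (3 * p - k - 6 * b * q - b ^ 2 * k - 3 * b ^ 2 * p + 2 * b * h) / 2 := by
    rw [hk, hp, hq]
    field_simp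
    ring
  clear hk hp hq
  refine ⟨A, B, C, ?_, ?_⟩
  · linear_combination e2 - h ^ 2 * B
  · linear_combination e1 + h ^ 4 * A
end

section
/- Let h, b, c, α, β, γ, δ, ε be real numbers with h ≠ 0. If (k, p, q) and (k', p', q') are two triples of real numbers such that α, β, γ, δ, ε are the fold coefficients of both (h, b, c, k, p, q) and (h, b, c, k', p', q'), then k = k', p = p', and q = q'. (The linear system in k, p, q determined by the fold-coefficient equations has at most one solution.) -/
/-- With `h ≠ 0`, the linear system in `k, p, q` given by the fold-coefficient
equations has at most one solution. -/
theorem fold_system_unique_solution (h b c α β γ δ ε : ℝ) (hh : h ≠ 0)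
    (k p q k' p' q' : ℝ)
    (hα : α = (-k - p + 2 * b * q - b ^ 2 * k + b ^ 2 * p - 12 * b * h - 2 * c) / 4)
    (hβ : β = h * (q + 2 * b * p - b ^ 2 * q + b * c - h + 2 * b ^ 2 * h))
    (hγ : γ = h ^ 2 * (3 * p - k - 6 * b * q - b ^ 2 * k - 3 * b ^ 2 * p + 2 * b * h) / 2)
    (hδ : δ = -(h ^ 3) * (q + 2 * b * p - b ^ 2 * q - b * c))
    (hε : ε = h ^ 4 * (-k - p + 2 * b * q - b ^ 2 * k + b ^ 2 * p + 2 * c) / 4)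
    (hα' : α = (-k' - p' + 2 * b * q' - b ^ 2 * k' + b ^ 2 * p' - 12 * b * h - 2 * c) / 4)
    (hβ' : β = h * (q' + 2 * b * p' - b ^ 2 * q' + b * c - h + 2 * b ^ 2 * h))
    (hγ' : γ = h ^ 2 * (3 * p' - k' - 6 * b * q' - b ^ 2 * k' - 3 * b ^ 2 * p' + 2 * b * h) / 2)
    (hδ' : δ = -(h ^ 3) * (q' + 2 * b * p' - b ^ 2 * q' - b * c))
    (hε' : ε = h ^ 4 * (-k' - p' + 2 * b * q' - b ^ 2 * k' + b ^ 2 * p' + 2 * c) / 4) :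
    k = k' ∧ p = p' ∧ q = q' := by
  have hB := mul_left_cancel₀ hh (hβ.symm.trans hβ')
  have h2 : h ^ 2 ≠ 0 := pow_ne_zero 2 hh
  have hC : 3 * p - k - 6 * b * q - b ^ 2 * k - 3 * b ^ 2 * p + 2 * b * h
      = 3 * p' - k' - 6 * b * q' - b ^ 2 * k' - 3 * b ^ 2 * p' + 2 * b * h := by
    apply mul_left_cancel₀ h2
    linarith
  have hb : (1 + b ^ 2) ≠ 0 := by positivity
  have hb2 : (1 + b ^ 2) ^ 2 ≠ 0 := by positivity
  have hX : (1 - b ^ 2) * (p - p') - 2 * b * (q - q') = 0 := by linarith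
  have hY : 2 * b * (p - p') + (1 - b ^ 2) * (q - q') = 0 := by linarith
  refine ⟨?_, ?_, ?_⟩
  · apply mul_left_cancel₀ hb
    linarith
  · apply mul_left_cancel₀ hb2
    linear_combination (1 - b ^ 2) * hX + 2 * b * hY
  · apply mul_left_cancel₀ hb2
    linear_combination (1 - b ^ 2) * hY - 2 * b * hX
end

section
/- Let α, β, γ, δ, ε be arbitrary real numbers with ε ≠ 0. Then there exist real numbers h, b, c, k, p, q with h ≠ 0 such that α, β, γ, δ, ε are the fold coefficients of (h, b, c, k, p, q). (Hence every quintic t⁵ + αt⁴ + βt³ + γt² + δt + ε with ε ≠ 0 arises from a two-fold origami configuration determined by the points Q(0, h), P(p, q) and the lines m: y = −h, ℓ: x = k, n: x + by = c.) -/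
/-- Every quintic `t⁵ + αt⁴ + βt³ + γt² + δt + ε` with `ε ≠ 0` arises from a two-fold
origami configuration: there exist `h, b, c, k, p, q` with `h ≠ 0` whose fold
coefficients are `α, β, γ, δ, ε`. -/
theorem quintic_has_fold_configuration (α β γ δ ε : ℝ) (hε : ε ≠ 0) :
    ∃ h b c k p q : ℝ, h ≠ 0 ∧
      α = (-k - p + 2 * b * q - b ^ 2 * k + b ^ 2 * p - 12 * b * h - 2 * c) / 4 ∧
      β = h * (q + 2 * b * p - b ^ 2 * q + b * c - h + 2 * b ^ 2 * h) ∧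
      γ = h ^ 2 * (3 * p - k - 6 * b * q - b ^ 2 * k - 3 * b ^ 2 * p + 2 * b * h) / 2 ∧
      δ = -(h ^ 3) * (q + 2 * b * p - b ^ 2 * q - b * c) ∧
      ε = h ^ 4 * (-k - p + 2 * b * q - b ^ 2 * k + b ^ 2 * p + 2 * c) / 4 := by
  obtain ⟨h, hh, hD⟩ : ∃ h : ℝ, h ≠ 0 ∧
      0 < (ε - α * h ^ 4) ^ 2 - 4 * h ^ 10 - 4 * β * h ^ 8 - 4 * δ * h ^ 6 := by
    have hc : Continuous (fun h : ℝ =>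
        (ε - α * h ^ 4) ^ 2 - 4 * h ^ 10 - 4 * β * h ^ 8 - 4 * δ * h ^ 6) := by fun_prop
    have h0 : 0 < (fun h : ℝ =>
        (ε - α * h ^ 4) ^ 2 - 4 * h ^ 10 - 4 * β * h ^ 8 - 4 * δ * h ^ 6) 0 := by
      have : 0 < ε ^ 2 := by positivity
      simpa using this
    have hev := hc.continuousAt.eventually (lt_mem_nhds h0)
    obtain ⟨r, hr, hb⟩ := Metric.eventually_nhds_iff.mp hev
    refine ⟨r / 2, by positivity, hb ?_⟩
    rw [Real.dist_eq, sub_zero, abs_of_pos (by positivity)]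
    linarith
  obtain ⟨s, hs⟩ : ∃ s : ℝ, s ^ 2 =
      (ε - α * h ^ 4) ^ 2 - 4 * h ^ 10 - 4 * β * h ^ 8 - 4 * δ * h ^ 6 :=
    ⟨_, Real.sq_sqrt hD.le⟩
  obtain ⟨b, hb⟩ : ∃ b : ℝ, b * (4 * h ^ 5) = ε - α * h ^ 4 + s :=
    ⟨(ε - α * h ^ 4 + s) / (4 * h ^ 5), by field_simp⟩
  obtain ⟨e, he⟩ : ∃ e : ℝ, ε = e * h ^ 4 := ⟨ε / h ^ 4, by field_simp⟩
  obtain ⟨g, hg⟩ : ∃ g : ℝ, γ = g * h ^ 2 := ⟨γ / h ^ 2, by field_simp⟩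
  obtain ⟨d, hd⟩ : ∃ d : ℝ, δ = d * h ^ 3 := ⟨δ / h ^ 3, by field_simp⟩
  have hs' : s = b * (4 * h ^ 5) - (ε - α * h ^ 4) := by linarith
  have key : β = h * (-d + 2 * b * (e - α - 3 * b * h) - h + 2 * b ^ 2 * h) := by
    rw [hs'] at hs
    subst he hd
    have h8 : (4 * h ^ 8) ≠ 0 := by positivity
    apply mul_left_cancel₀ h8
    linear_combination hs
  have hbb : (1 + b ^ 2) ≠ 0 := by positivity
  obtain ⟨c, hc⟩ : ∃ c : ℝ, c = e - α - 3 * b * h := ⟨_, rfl⟩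
  obtain ⟨V, hV⟩ : ∃ V : ℝ, V = b * c - d := ⟨_, rfl⟩
  obtain ⟨U, hU⟩ : ∃ U : ℝ, U = (2 * c - 4 * e + 2 * g - 2 * b * h) / 4 := ⟨_, rfl⟩
  obtain ⟨K, hK⟩ : ∃ K : ℝ, K = 2 * c - 4 * e - U := ⟨_, rfl⟩
  obtain ⟨k, hk⟩ : ∃ k : ℝ, k * (1 + b ^ 2) = K := ⟨K / (1 + b ^ 2), by field_simp⟩
  obtain ⟨p, q, hp, hq⟩ : ∃ p q : ℝ, (1 - b ^ 2) * p - 2 * b * q = U ∧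
      (1 - b ^ 2) * q + 2 * b * p = V :=
    ⟨((1 - b ^ 2) * U + 2 * b * V) / (1 + b ^ 2) ^ 2,
      ((1 - b ^ 2) * V - 2 * b * U) / (1 + b ^ 2) ^ 2,
      by field_simp; ring, by field_simp; ring⟩
  refine ⟨h, b, c, k, p, q, hh, ?_, ?_, ?_, ?_, ?_⟩
  · linear_combination (hk + hp + hK + 2 * hc) / 4 + hc / 2
  · rw [key]
    linear_combination -h * (hq + hV) - 2 * b * h * hc
  · rw [hg]
    linear_combination h ^ 2 / 2 * (hk - 3 * hp + hK - 4 * hU)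
  · rw [hd]
    linear_combination h ^ 3 * (hq + hV)
  · rw [he]
    linear_combination h ^ 4 / 4 * (hk + hp + hK)
end

section
/- Let h, b, c, k, p, q be real numbers and let α, β, γ, δ, ε be their fold coefficients. Then the following polynomial identity holds: −h⁵ + α·b·h⁴ − β·b²·h³ + γ·b³·h² − δ·b⁴·h + ε·b⁵ = −(h⁴(1 + b²)²/4)·(4h + b(k + p) + 2b(bq + c) + b³(k − p)). In particular, if b ≠ 0 and h ≠ 0, then t = −h/b is a root of t⁵ + αt⁴ + βt³ + γt² + δt + ε = 0 if and only if 4h + b(k + p) + 2b(bq + c) + b³(k − p) = 0. (The parallel-fold case is thus contained in the generic intersecting case.) -/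
/-- For fold coefficients `α, β, γ, δ, ε` of `(h, b, c, k, p, q)`, the polynomial
identity relating the quintic evaluated (up to sign and scaling) at `t = -h/b` to the
parallel-fold condition holds; in particular if `b ≠ 0` and `h ≠ 0` then `t = -h/b`
is a root of the quintic iff `4h + b(k + p) + 2b(bq + c) + b³(k - p) = 0`. -/
theorem parallel_case_contained (h b c k p q α β γ δ ε : ℝ)
    (hα : α = (-k - p + 2 * b * q - b ^ 2 * k + b ^ 2 * p - 12 * b * h - 2 * c) / 4)
    (hβ : β = h * (q + 2 * b * p - b ^ 2 * q + b * c - h + 2 * b ^ 2 * h))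
    (hγ : γ = h ^ 2 * (3 * p - k - 6 * b * q - b ^ 2 * k - 3 * b ^ 2 * p + 2 * b * h) / 2)
    (hδ : δ = -(h ^ 3) * (q + 2 * b * p - b ^ 2 * q - b * c))
    (hε : ε = h ^ 4 * (-k - p + 2 * b * q - b ^ 2 * k + b ^ 2 * p + 2 * c) / 4) :
    (-(h ^ 5) + α * b * h ^ 4 - β * b ^ 2 * h ^ 3 + γ * b ^ 3 * h ^ 2
        - δ * b ^ 4 * h + ε * b ^ 5
      = -(h ^ 4 * (1 + b ^ 2) ^ 2 / 4) *
          (4 * h + b * (k + p) + 2 * b * (b * q + c) + b ^ 3 * (k - p))) ∧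
    (b ≠ 0 → h ≠ 0 →
      (((-h / b) ^ 5 + α * (-h / b) ^ 4 + β * (-h / b) ^ 3 + γ * (-h / b) ^ 2
          + δ * (-h / b) + ε = 0) ↔
        4 * h + b * (k + p) + 2 * b * (b * q + c) + b ^ 3 * (k - p) = 0)) := by
  have key : -(h ^ 5) + α * b * h ^ 4 - β * b ^ 2 * h ^ 3 + γ * b ^ 3 * h ^ 2
        - δ * b ^ 4 * h + ε * b ^ 5
      = -(h ^ 4 * (1 + b ^ 2) ^ 2 / 4) *
          (4 * h + b * (k + p) + 2 * b * (b * q + c) + b ^ 3 * (k - p)) := by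
    subst hα hβ hγ hδ hε
    ring
  refine ⟨key, fun hb hh => ?_⟩
  have e : ((-h / b) ^ 5 + α * (-h / b) ^ 4 + β * (-h / b) ^ 3 + γ * (-h / b) ^ 2
          + δ * (-h / b) + ε) * b ^ 5 = -(h ^ 5) + α * b * h ^ 4 - β * b ^ 2 * h ^ 3
          + γ * b ^ 3 * h ^ 2 - δ * b ^ 4 * h + ε * b ^ 5 := by
    clear key hα hβ hγ hδ hε
    field_simp
    ring
  have hb5 : b ^ 5 ≠ 0 := pow_ne_zero 5 hb
  have hc : -(h ^ 4 * (1 + b ^ 2) ^ 2 / 4) ≠ 0 := by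
    have : 0 < h ^ 4 * (1 + b ^ 2) ^ 2 / 4 := by positivity
    exact neg_ne_zero.mpr (ne_of_gt this)
  rw [key] at e
  constructor
  · intro h0
    rw [h0, zero_mul] at e
    exact (mul_eq_zero.mp e.symm).resolve_left hc
  · intro h0
    rw [h0, mul_zero] at e
    exact (mul_eq_zero.mp e).resolve_right hb5
end

section
/- For every real number t, t⁵ + t⁴ − 4t³ − 3t² + 3t + 1 = ∏_{i=1}^{5} (t − 2·cos(2πi/11)). In particular, for each i ∈ {1, 2, 3, 4, 5}, the real number t = 2·cos(2πi/11) satisfies t⁵ + t⁴ − 4t³ − 3t² + 3t + 1 = 0. -/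
open Real

lemma hend_aux (a t : ℝ) (h : a ^ 5 + a ^ 4 - 4 * a ^ 3 - 3 * a ^ 2 + 3 * a + 1 = 0) :
    t ^ 5 + t ^ 4 - 4 * t ^ 3 - 3 * t ^ 2 + 3 * t + 1 =
      (t - a) * (t - (a ^ 2 - 2)) * (t - (a ^ 3 - 3 * a)) * (t - (a ^ 4 - 4 * a ^ 2 + 2)) *
        (t - (a ^ 5 - 5 * a ^ 3 + 5 * a)) := by
  grind

/-- The hendecagon quintic factors as
`t⁵ + t⁴ - 4t³ - 3t² + 3t + 1 = ∏_{i=1}^{5} (t - 2cos(2πi/11))`; in particular each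
`t = 2cos(2πi/11)`, `i = 1, ..., 5`, is a root. -/
theorem hendecagon_quintic_roots :
    (∀ t : ℝ, t ^ 5 + t ^ 4 - 4 * t ^ 3 - 3 * t ^ 2 + 3 * t + 1 =
      ∏ i ∈ Finset.Icc (1 : ℕ) 5, (t - 2 * Real.cos (2 * Real.pi * (i : ℝ) / 11))) ∧
    ∀ i ∈ Finset.Icc (1 : ℕ) 5,
      (2 * Real.cos (2 * Real.pi * (i : ℝ) / 11)) ^ 5
        + (2 * Real.cos (2 * Real.pi * (i : ℝ) / 11)) ^ 4
        - 4 * (2 * Real.cos (2 * Real.pi * (i : ℝ) / 11)) ^ 3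
        - 3 * (2 * Real.cos (2 * Real.pi * (i : ℝ) / 11)) ^ 2
        + 3 * (2 * Real.cos (2 * Real.pi * (i : ℝ) / 11)) + 1 = 0 := by
  have key : ∀ t : ℝ, t ^ 5 + t ^ 4 - 4 * t ^ 3 - 3 * t ^ 2 + 3 * t + 1 =
      ∏ i ∈ Finset.Icc (1 : ℕ) 5, (t - 2 * Real.cos (2 * Real.pi * (i : ℝ) / 11)) := by
    intro t
    obtain ⟨θ, hθ⟩ : ∃ θ : ℝ, θ = 2 * Real.pi / 11 := ⟨_, rfl⟩
    have h2 : Real.cos (2 * θ) = 2 * Real.cos θ ^ 2 - 1 := Real.cos_two_mul θ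
    have h3 : Real.cos (3 * θ) = 4 * Real.cos θ ^ 3 - 3 * Real.cos θ := Real.cos_three_mul θ
    have h4 : Real.cos (4 * θ) = 2 * Real.cos (2 * θ) ^ 2 - 1 := by
      rw [← Real.cos_two_mul]; ring_nf
    have h6 : Real.cos (6 * θ) = 2 * Real.cos (3 * θ) ^ 2 - 1 := by
      rw [← Real.cos_two_mul]; ring_nf
    have h5 : Real.cos (5 * θ) = 2 * Real.cos (3 * θ) * Real.cos (2 * θ) - Real.cos θ := by
      have e1 := Real.cos_add (3 * θ) (2 * θ)
      have e2 := Real.cos_sub (3 * θ) (2 * θ)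
      rw [show 3 * θ + 2 * θ = 5 * θ by ring] at e1
      rw [show 3 * θ - 2 * θ = θ by ring] at e2
      linarith
    have h65 : Real.cos (6 * θ) = Real.cos (5 * θ) := by
      rw [← Real.cos_two_pi_sub, hθ]; congr 1; ring
    have hlt : Real.cos θ < 1 := by
      rw [← Real.cos_zero]
      apply Real.cos_lt_cos_of_nonneg_of_le_pi le_rfl <;> rw [hθ] <;> linarith [Real.pi_pos]
    have hq : (2 * Real.cos θ) ^ 5 + (2 * Real.cos θ) ^ 4 - 4 * (2 * Real.cos θ) ^ 3
        - 3 * (2 * Real.cos θ) ^ 2 + 3 * (2 * Real.cos θ) + 1 = 0 := by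
      have hne : 2 * Real.cos θ - 2 ≠ 0 := by linarith
      apply mul_left_cancel₀ hne
      rw [h6, h5, h3, h2] at h65
      linear_combination 2 * h65
    rw [hend_aux _ t hq]
    have hp : ∀ i : ℝ, 2 * Real.pi * i / 11 = i * θ := by intro i; rw [hθ]; ring
    simp only [hp]
    simp only [Finset.prod_Icc_succ_top (show 1 ≤ 4 + 1 by norm_num),
      Finset.prod_Icc_succ_top (show 1 ≤ 3 + 1 by norm_num),
      Finset.prod_Icc_succ_top (show 1 ≤ 2 + 1 by norm_num),
      Finset.prod_Icc_succ_top (show 1 ≤ 1 + 1 by norm_num), Finset.Icc_self,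
      Finset.prod_singleton]
    norm_num only [Nat.cast_ofNat, Nat.cast_one, one_mul]
    rw [h5, h4, h3, h2]
    ring
  refine ⟨key, fun i hi => ?_⟩
  rw [key]
  exact Finset.prod_eq_zero hi (sub_self _)
end
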